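/- arXiv:2302.03125 — 4 statements merged into one kernel-verified Lean document; each statement's English description precedes it below -/
import Mathlib

section
/- For all real numbers x₁ > 0, x₂ > 0 and t > 0, the convolution identity ∫_0^t h(s, x₁) · h(t − s, x₂) ds = h(t, x₁ + x₂) holds. -/
/-- First passage time density of Brownian motion started at `z`. -/
noncomputable def h (s z : ℝ) : ℝ :=
  z / (Real.sqrt (2 * Real.pi) * s ^ ((3 : ℝ) / 2)) * Real.exp (-z ^ 2 / (2 * s))

open MeasureTheory Set Filter Topology

theorem integral_eq_sub_of_hasDerivAt_of_nonneg_of_tendsto {f f' : ℝ → ℝ} {a b fa fb : ℝ}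
    (hab : a < b) (hderiv : ∀ x ∈ Ioo a b, HasDerivAt f (f' x) x)
    (hnonneg : ∀ x ∈ Ioo a b, 0 ≤ f' x)
    (ha : Tendsto f (𝓝[>] a) (𝓝 fa)) (hb : Tendsto f (𝓝[<] b) (𝓝 fb)) :
    ∫ x in a..b, f' x = fb - fa := by
  have hcont : ContinuousOn f (Ioo a b) := fun x hx =>
    (hderiv x hx).continuousAt.continuousWithinAt
  refine intervalIntegral.integral_eq_sub_of_hasDerivAt_of_tendsto hab hderiv ?_ ha hb
  rw [intervalIntegrable_iff_integrableOn_Ioc_of_le hab.le]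
  refine intervalIntegral.integrableOn_deriv_of_nonneg
    (continuousOn_Icc_extendFrom_Ioo hcont ha hb) (fun x hx => ?_) hnonneg
  refine (hderiv x hx).congr_of_eventuallyEq ?_
  filter_upwards [Ioo_mem_nhds hx.1 hx.2] with y hy
  exact extendFrom_extends hcont y hy

/-- The primitive of the Gaussian `v ↦ exp (-b * v ^ 2)` vanishing at `0`. -/
noncomputable def gaussianPrimitive (b y : ℝ) : ℝ :=
  ∫ v in (0 : ℝ)..y, Real.exp (-b * v ^ 2)

theorem hasDerivAt_gaussianPrimitive (b y : ℝ) :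
    HasDerivAt (gaussianPrimitive b) (Real.exp (-b * y ^ 2)) y := by
  have hc : Continuous fun v : ℝ => Real.exp (-b * v ^ 2) := by fun_prop
  exact hc.integral_hasStrictDerivAt 0 y |>.hasDerivAt

theorem gaussianPrimitive_neg (b y : ℝ) :
    gaussianPrimitive b (-y) = -gaussianPrimitive b y := by
  have := intervalIntegral.integral_comp_neg (a := 0) (b := y)
    (fun v : ℝ => Real.exp (-b * v ^ 2))
  simp only [neg_sq, neg_zero] at this
  rw [gaussianPrimitive, gaussianPrimitive, this, intervalIntegral.integral_symm]

theorem tendsto_gaussianPrimitive_atTop {b : ℝ} (hb : 0 < b) :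
    Tendsto (gaussianPrimitive b) atTop (𝓝 (√(Real.pi / b) / 2)) := by
  rw [← integral_gaussian_Ioi b]
  exact intervalIntegral_tendsto_integral_Ioi 0 (integrable_exp_neg_mul_sq hb).integrableOn
    tendsto_id

theorem tendsto_gaussianPrimitive_atBot {b : ℝ} (hb : 0 < b) :
    Tendsto (gaussianPrimitive b) atBot (𝓝 (-(√(Real.pi / b) / 2))) := by
  refine ((tendsto_gaussianPrimitive_atTop hb).comp tendsto_neg_atBot_atTop).neg.congr
    fun y => ?_
  simp [gaussianPrimitive_neg]

theorem tendsto_sqrt_div_sqrt_sub_nhdsGT_zero {t : ℝ} (ht : 0 < t) :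
    Tendsto (fun s : ℝ => √s / √(t - s)) (𝓝[>] 0) (𝓝[>] 0) := by
  refine tendsto_nhdsWithin_iff.2 ⟨?_, ?_⟩
  · have hc : ContinuousAt (fun s : ℝ => √s / √(t - s)) 0 := by
      refine ContinuousAt.div (by fun_prop) (by fun_prop) ?_
      simpa using (Real.sqrt_pos.2 ht).ne'
    simpa using hc.tendsto.mono_left nhdsWithin_le_nhds
  · filter_upwards [Ioo_mem_nhdsGT ht] with s hs
    exact div_pos (Real.sqrt_pos.2 hs.1) (Real.sqrt_pos.2 (sub_pos.2 hs.2))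

theorem tendsto_sqrt_div_sqrt_sub_nhdsLT {t : ℝ} (ht : 0 < t) :
    Tendsto (fun s : ℝ => √s / √(t - s)) (𝓝[<] t) atTop := by
  have hnum : Tendsto (fun s : ℝ => √s) (𝓝[<] t) (𝓝 √t) :=
    (Real.continuous_sqrt.tendsto t).mono_left nhdsWithin_le_nhds
  have hden : Tendsto (fun s : ℝ => √(t - s)) (𝓝[<] t) (𝓝[>] 0) := by
    refine tendsto_nhdsWithin_iff.2 ⟨?_, ?_⟩
    · have hc : Continuous fun s : ℝ => √(t - s) := by fun_prop
      simpa using (hc.tendsto t).mono_left nhdsWithin_le_nhds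
    · filter_upwards [self_mem_nhdsWithin] with s hs
      exact Real.sqrt_pos.2 (sub_pos.2 hs)
  simpa only [div_eq_mul_inv, Pi.inv_apply] using
    hnum.pos_mul_atTop (Real.sqrt_pos.2 ht) hden.inv_tendsto_nhdsGT_zero

theorem tendsto_mul_sub_mul_inv_nhdsGT_zero {x : ℝ} (hx : 0 < x) (y : ℝ) :
    Tendsto (fun w : ℝ => y * w - x * w⁻¹) (𝓝[>] 0) atBot := by
  have h₁ : Tendsto (fun w : ℝ => y * w) (𝓝[>] 0) (𝓝 (y * 0)) :=
    (continuous_const_mul y).continuousAt.tendsto.mono_left nhdsWithin_le_nhds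
  have h₂ : Tendsto (fun w : ℝ => -(x * w⁻¹)) (𝓝[>] 0) atBot :=
    tendsto_neg_atTop_atBot.comp (tendsto_inv_nhdsGT_zero.const_mul_atTop hx)
  simpa only [sub_eq_add_neg] using h₁.add_atBot h₂

theorem tendsto_mul_sub_mul_inv_atTop (x : ℝ) {y : ℝ} (hy : 0 < y) :
    Tendsto (fun w : ℝ => y * w - x * w⁻¹) atTop atTop := by
  have h₁ : Tendsto (fun w : ℝ => y * w) atTop atTop := tendsto_id.const_mul_atTop hy
  have h₂ : Tendsto (fun w : ℝ => -(x * w⁻¹)) atTop (𝓝 (-(x * 0))) :=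
    (tendsto_inv_atTop_zero.const_mul x).neg
  simpa only [sub_eq_add_neg] using h₁.atTop_add h₂

/-- The building block of an antiderivative of `s ↦ h s x * h (t - s) y`. -/
noncomputable def passagePrimitive (t x y s : ℝ) : ℝ :=
  (x + y) * Real.exp (-(x + y) ^ 2 / (2 * t)) *
    gaussianPrimitive (1 / (2 * t)) (y * (√s / √(t - s)) - x * (√s / √(t - s))⁻¹)

theorem hasDerivAt_passagePrimitive (x y : ℝ) {t s : ℝ} (hs : s ∈ Ioo 0 t) :
    HasDerivAt (passagePrimitive t x y)
      ((x + y) * (x / s + y / (t - s)) * (t / (2 * (√s * √(t - s)))) *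
        Real.exp (-x ^ 2 / (2 * s) - y ^ 2 / (2 * (t - s)))) s := by
  obtain ⟨hs0, hst⟩ := hs
  have hts : 0 < t - s := sub_pos.2 hst
  have ht : 0 < t := hs0.trans hst
  have hA : 0 < √s := Real.sqrt_pos.2 hs0
  have hB : 0 < √(t - s) := Real.sqrt_pos.2 hts
  have hdA : HasDerivAt (fun s : ℝ => √s) (1 / (2 * √s)) s := Real.hasDerivAt_sqrt hs0.ne'
  have hdB : HasDerivAt (fun s : ℝ => √(t - s)) (-1 / (2 * √(t - s))) s :=
    ((hasDerivAt_id s).const_sub t).sqrt hts.ne'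
  have hw := hdA.fun_div hdB hB.ne'
  have hp := (hw.const_mul y).fun_sub ((hw.fun_inv (div_pos hA hB).ne').const_mul x)
  have hG := ((hasDerivAt_gaussianPrimitive (1 / (2 * t)) _).comp s hp).const_mul
    ((x + y) * Real.exp (-(x + y) ^ 2 / (2 * t)))
  refine hG.congr_deriv ?_
  have hAs : s = √s ^ 2 := (Real.sq_sqrt hs0.le).symm
  have hBs : t - s = √(t - s) ^ 2 := (Real.sq_sqrt hts.le).symm
  have hexp : Real.exp (-x ^ 2 / (2 * s) - y ^ 2 / (2 * (t - s))) =
      Real.exp (-(x + y) ^ 2 / (2 * t)) * Real.exp (-(1 / (2 * t)) *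
        (y * (√s / √(t - s)) - x * (√s / √(t - s))⁻¹) ^ 2) := by
    rw [← Real.exp_add]
    congr 1
    generalize √(t - s) = B at *
    generalize √s = A at *
    obtain rfl : t = A ^ 2 + B ^ 2 := by linarith
    subst hAs
    rw [hBs]
    field_simp
    ring
  rw [hexp]
  generalize Real.exp (-(1 / (2 * t)) *
    (y * (√s / √(t - s)) - x * (√s / √(t - s))⁻¹) ^ 2) = E
  generalize Real.exp (-(x + y) ^ 2 / (2 * t)) = E'
  clear hexp hG hp hw hdA hdB
  generalize √(t - s) = B at *
  generalize √s = A at *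
  obtain rfl : t = A ^ 2 + B ^ 2 := by linarith
  subst hAs
  rw [hBs]
  field_simp
  ring

theorem tendsto_passagePrimitive_nhdsLT {t y : ℝ} (ht : 0 < t) (x : ℝ) (hy : 0 < y) :
    Tendsto (passagePrimitive t x y) (𝓝[<] t)
      (𝓝 ((x + y) * Real.exp (-(x + y) ^ 2 / (2 * t)) * (√(Real.pi / (1 / (2 * t))) / 2))) :=
  (((tendsto_gaussianPrimitive_atTop (by positivity)).comp
    (tendsto_mul_sub_mul_inv_atTop x hy)).comp
      (tendsto_sqrt_div_sqrt_sub_nhdsLT ht)).const_mul _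

theorem tendsto_passagePrimitive_nhdsGT_zero {t x : ℝ} (ht : 0 < t) (hx : 0 < x) (y : ℝ) :
    Tendsto (passagePrimitive t x y) (𝓝[>] 0)
      (𝓝 ((x + y) * Real.exp (-(x + y) ^ 2 / (2 * t)) * -(√(Real.pi / (1 / (2 * t))) / 2))) :=
  (((tendsto_gaussianPrimitive_atBot (by positivity)).comp
    (tendsto_mul_sub_mul_inv_nhdsGT_zero hx y)).comp
      (tendsto_sqrt_div_sqrt_sub_nhdsGT_zero ht)).const_mul _

theorem tendsto_passagePrimitive_neg_nhdsGT_zero {t x : ℝ} (ht : 0 < t) (hx : 0 < x) (y : ℝ) :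
    Tendsto (passagePrimitive t (-x) y) (𝓝[>] 0)
      (𝓝 ((-x + y) * Real.exp (-(-x + y) ^ 2 / (2 * t)) * (√(Real.pi / (1 / (2 * t))) / 2))) := by
  have hp : Tendsto (fun w : ℝ => y * w - -x * w⁻¹) (𝓝[>] 0) atTop := by
    refine (tendsto_neg_atBot_atTop.comp
      (tendsto_mul_sub_mul_inv_nhdsGT_zero hx (-y))).congr fun w => ?_
    simp only [Function.comp_apply]
    ring
  exact (((tendsto_gaussianPrimitive_atTop (by positivity)).comp hp).comp
    (tendsto_sqrt_div_sqrt_sub_nhdsGT_zero ht)).const_mul _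

theorem rpow_three_halves {s : ℝ} (hs : 0 < s) : s ^ ((3 : ℝ) / 2) = √s ^ 3 := by
  rw [Real.sqrt_eq_rpow, ← Real.rpow_natCast, ← Real.rpow_mul hs.le]
  norm_num

theorem hasDerivAt_h_mul_h (x y : ℝ) {t s : ℝ} (hs : s ∈ Ioo 0 t) :
    HasDerivAt (fun s => 1 / (2 * Real.pi * t ^ 2) *
      (passagePrimitive t x y s - passagePrimitive t (-x) y s)) (h s x * h (t - s) y) s := by
  refine (((hasDerivAt_passagePrimitive x y hs).sub
    (hasDerivAt_passagePrimitive (-x) y hs)).const_mul _).congr_deriv ?_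
  obtain ⟨hs0, hst⟩ := hs
  have hts : 0 < t - s := sub_pos.2 hst
  have hA : 0 < √s := Real.sqrt_pos.2 hs0
  have hB : 0 < √(t - s) := Real.sqrt_pos.2 hts
  have hexp : Real.exp (-x ^ 2 / (2 * s) - y ^ 2 / (2 * (t - s))) =
      Real.exp (-x ^ 2 / (2 * s)) * Real.exp (-y ^ 2 / (2 * (t - s))) := by
    rw [← Real.exp_add]
    congr 1
    ring
  rw [h, h, rpow_three_halves hs0, rpow_three_halves hts, neg_sq, hexp]
  generalize Real.exp (-x ^ 2 / (2 * s)) = E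
  generalize Real.exp (-y ^ 2 / (2 * (t - s))) = E'
  have hpi : 0 < √(2 * Real.pi) := by positivity
  have hpi2 : 2 * Real.pi = √(2 * Real.pi) ^ 2 := (Real.sq_sqrt (by positivity)).symm
  have hAs : s = √s ^ 2 := (Real.sq_sqrt hs0.le).symm
  have hBs : t - s = √(t - s) ^ 2 := (Real.sq_sqrt hts.le).symm
  rw [hpi2, Real.sqrt_sq hpi.le]
  generalize √(2 * Real.pi) = P at *
  generalize √(t - s) = B at *
  generalize √s = A at *
  obtain rfl : t = A ^ 2 + B ^ 2 := by linarith
  subst hAs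
  rw [hBs]
  field_simp
  ring

theorem h_nonneg {s z : ℝ} (hs : 0 ≤ s) (hz : 0 ≤ z) : 0 ≤ h s z := by
  unfold h
  positivity

/-- Convolution identity for first passage densities (equation (4.1)). -/
theorem h_convolution (x₁ x₂ t : ℝ) (hx₁ : 0 < x₁) (hx₂ : 0 < x₂) (ht : 0 < t) :
    ∫ s in (0 : ℝ)..t, h s x₁ * h (t - s) x₂ = h t (x₁ + x₂) := by
  rw [integral_eq_sub_of_hasDerivAt_of_nonneg_of_tendsto ht
    (fun s hs => hasDerivAt_h_mul_h x₁ x₂ hs)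
    (fun s hs => mul_nonneg (h_nonneg hs.1.le hx₁.le) (h_nonneg (sub_nonneg.2 hs.2.le) hx₂.le))
    (((tendsto_passagePrimitive_nhdsGT_zero ht hx₁ x₂).sub
      (tendsto_passagePrimitive_neg_nhdsGT_zero ht hx₁ x₂)).const_mul _)
    (((tendsto_passagePrimitive_nhdsLT ht x₁ hx₂).sub
      (tendsto_passagePrimitive_nhdsLT ht (-x₁) hx₂)).const_mul _)]
  have hsqrt : √(Real.pi / (1 / (2 * t))) = √(2 * Real.pi) * √t := by
    rw [← Real.sqrt_mul (by positivity)]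
    congr 1
    field_simp
  rw [h, rpow_three_halves ht, hsqrt]
  generalize Real.exp (-(x₁ + x₂) ^ 2 / (2 * t)) = E
  have hpi : 0 < √(2 * Real.pi) := by positivity
  have hpi2 : 2 * Real.pi = √(2 * Real.pi) ^ 2 := (Real.sq_sqrt (by positivity)).symm
  have hT : 0 < √t := Real.sqrt_pos.2 ht
  have hT2 : t ^ 2 = √t ^ 4 := by
    rw [show √t ^ 4 = (√t ^ 2) ^ 2 by ring, Real.sq_sqrt ht.le]
  rw [hpi2, Real.sqrt_sq hpi.le, hT2]
  field_simp
  ring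
end

section
/- Let r > 0 and θ > 0, and define g(t, z) = θ · exp(2rθz + 2r²θ²t) · erfc(z/√(2t) + rθ·√(2t)) for t > 0 and z ≥ 0. Then for every z ≥ 0 and λ > 0, ∫_0^∞ exp(−λt) · g(t, z) dt = θ · exp(−z·√(2λ)) / (λ + √(2λ)·r·θ). -/
/-- The complementary error function. -/
noncomputable def erfc (x : ℝ) : ℝ :=
  (2 / Real.sqrt Real.pi) * ∫ u in Set.Ioi x, Real.exp (-u ^ 2)

/-- The kernel of the transition function of the oscillating sticky Brownian motion
(Proposition 2.4, with corrected exponent). -/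
noncomputable def g (r θ t z : ℝ) : ℝ :=
  θ * Real.exp (2 * r * θ * z + 2 * r ^ 2 * θ ^ 2 * t) *
    erfc (z / Real.sqrt (2 * t) + r * θ * Real.sqrt (2 * t))

open MeasureTheory Set Filter Topology

/-- If `f` has derivative `f' ≥ 0` on `(a, ∞)`, a right limit `l` at `a` and a limit `m` at `∞`,
then `f'` is integrable on `(a, ∞)` with integral `m - l`. -/
theorem integrableOn_and_integral_Ioi_of_hasDerivAt_of_nonneg_of_tendsto {f f' : ℝ → ℝ} {a l m : ℝ}
    (hderiv : ∀ x ∈ Ioi a, HasDerivAt f (f' x) x) (hpos : ∀ x ∈ Ioi a, 0 ≤ f' x)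
    (ha : Tendsto f (𝓝[>] a) (𝓝 l)) (htop : Tendsto f atTop (𝓝 m)) :
    IntegrableOn f' (Ioi a) ∧ ∫ x in Ioi a, f' x = m - l := by
  rw [← Ici_sdiff_left] at ha
  have hcont : ContinuousWithinAt (Function.update f a l) (Ici a) a :=
    continuousWithinAt_update_same.mpr ha
  have hderiv' : ∀ x ∈ Ioi a, HasDerivAt (Function.update f a l) (f' x) x := by
    intro x hx
    apply (hderiv x hx).congr_of_eventuallyEq
    filter_upwards [eventually_ne_nhds (ne_of_gt hx)] with y hy
    exact Function.update_of_ne hy l f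
  have htop' : Tendsto (Function.update f a l) atTop (𝓝 m) := by
    apply htop.congr'
    filter_upwards [eventually_ne_atTop a] with x hx
    exact (Function.update_of_ne hx l f).symm
  refine ⟨integrableOn_Ioi_deriv_of_nonneg hcont hderiv' hpos htop', ?_⟩
  simpa using integral_Ioi_of_hasDerivAt_of_nonneg hcont hderiv' hpos htop'

theorem integrable_exp_neg_sq : Integrable fun u : ℝ => Real.exp (-u ^ 2) := by
  simpa using integrable_exp_neg_mul_sq one_pos

theorem hasDerivAt_integral_exp_neg_sq (x : ℝ) :
    HasDerivAt (fun y : ℝ => ∫ u in (0 : ℝ)..y, Real.exp (-u ^ 2)) (Real.exp (-x ^ 2)) x :=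
  intervalIntegral.integral_hasDerivAt_right integrable_exp_neg_sq.intervalIntegrable
    (Continuous.stronglyMeasurableAtFilter (by fun_prop) _ _) (by fun_prop)

theorem tendsto_integral_exp_neg_sq_atTop :
    Tendsto (fun y : ℝ => ∫ u in (0 : ℝ)..y, Real.exp (-u ^ 2)) atTop (𝓝 (√Real.pi / 2)) := by
  have h := intervalIntegral_tendsto_integral_Ioi 0 integrable_exp_neg_sq.integrableOn tendsto_id
  have h2 := integral_gaussian_Ioi 1
  simp only [neg_mul, one_mul, div_one] at h2
  rwa [h2] at h

theorem tendsto_integral_exp_neg_sq_atBot :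
    Tendsto (fun y : ℝ => ∫ u in (0 : ℝ)..y, Real.exp (-u ^ 2)) atBot (𝓝 (-(√Real.pi / 2))) := by
  have h := (tendsto_integral_exp_neg_sq_atTop.comp tendsto_neg_atBot_atTop).neg
  refine h.congr fun y => ?_
  have := intervalIntegral.integral_comp_neg (a := 0) (b := y) (fun u : ℝ => Real.exp (-u ^ 2))
  simp only [even_two.neg_pow, neg_zero] at this
  rw [Function.comp_apply, this, intervalIntegral.integral_symm, neg_neg]

/-- The Laplace transform of `exp (-y² / t) / √t` at `b²`. -/
theorem integrableOn_and_integral_exp_neg_mul_sub_div_div_sqrt {b y : ℝ} (hb : 0 < b) (hy : 0 < y) :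
    IntegrableOn (fun t => Real.exp (-b ^ 2 * t - y ^ 2 / t) / √t) (Ioi 0) ∧
      ∫ t in Ioi (0 : ℝ), Real.exp (-b ^ 2 * t - y ^ 2 / t) / √t =
        √Real.pi / b * Real.exp (-2 * b * y) := by
  set Φ : ℝ → ℝ := fun y => ∫ u in (0 : ℝ)..y, Real.exp (-u ^ 2) with hΦ
  have hs0 : Tendsto (fun t : ℝ => √t) (𝓝[>] 0) (𝓝[>] 0) := by
    refine tendsto_nhdsWithin_iff.2 ⟨?_, ?_⟩
    · have : Tendsto (fun t : ℝ => √t) (𝓝 0) (𝓝 √0) := Real.continuous_sqrt.tendsto 0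
      rw [Real.sqrt_zero] at this
      exact this.mono_left nhdsWithin_le_nhds
    · filter_upwards [self_mem_nhdsWithin] with t ht
      exact Real.sqrt_pos.2 ht
  have hb0 : Tendsto (fun t : ℝ => b * √t) (𝓝[>] 0) (𝓝 0) := by
    simpa using (hs0.mono_right nhdsWithin_le_nhds).const_mul b
  have hy0 : Tendsto (fun t : ℝ => y / √t) (𝓝[>] 0) atTop := by
    simpa [div_eq_mul_inv] using (tendsto_inv_nhdsGT_zero.comp hs0).const_mul_atTop hy
  have hbt : Tendsto (fun t : ℝ => b * √t) atTop atTop :=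
    Real.tendsto_sqrt_atTop.const_mul_atTop hb
  have hyt : Tendsto (fun t : ℝ => y / √t) atTop (𝓝 0) :=
    Real.tendsto_sqrt_atTop.const_div_atTop y
  have key := integrableOn_and_integral_Ioi_of_hasDerivAt_of_nonneg_of_tendsto (a := 0)
    (f := fun t => b⁻¹ * (Real.exp (-2 * b * y) * Φ (b * √t - y / √t)
      + Real.exp (2 * b * y) * Φ (b * √t + y / √t)))
    (f' := fun t => Real.exp (-b ^ 2 * t - y ^ 2 / t) / √t)
    (l := b⁻¹ * (Real.exp (-2 * b * y) * (-(√Real.pi / 2)) + Real.exp (2 * b * y) * (√Real.pi / 2)))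
    (m := b⁻¹ * (Real.exp (-2 * b * y) * (√Real.pi / 2) + Real.exp (2 * b * y) * (√Real.pi / 2)))
    ?_ ?_ ?_ ?_
  · refine ⟨key.1, key.2.trans ?_⟩
    field_simp
    ring
  · intro t ht
    have ht : 0 < t := ht
    have hst : 0 < √t := Real.sqrt_pos.2 ht
    have hsq : √t ^ 2 = t := Real.sq_sqrt ht.le
    have hd : HasDerivAt (fun t : ℝ => √t) (1 / (2 * √t)) t := Real.hasDerivAt_sqrt ht.ne'
    have hd1 := hd.const_mul b
    have hd2 := (hasDerivAt_const t y).fun_div hd hst.ne'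
    have hm := (hasDerivAt_integral_exp_neg_sq _).comp t (hd1.fun_sub hd2)
    have hp := (hasDerivAt_integral_exp_neg_sq _).comp t (hd1.fun_add hd2)
    have em : Real.exp (-2 * b * y) * Real.exp (-(b * √t - y / √t) ^ 2) =
        Real.exp (-b ^ 2 * t - y ^ 2 / t) := by
      rw [← Real.exp_add]
      congr 1
      nth_rewrite 3 4 [← hsq]
      field_simp
      ring
    have ep : Real.exp (2 * b * y) * Real.exp (-(b * √t + y / √t) ^ 2) =
        Real.exp (-b ^ 2 * t - y ^ 2 / t) := by
      rw [← Real.exp_add]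
      congr 1
      nth_rewrite 3 4 [← hsq]
      field_simp
      ring
    convert! ((hm.const_mul (Real.exp (-2 * b * y))).fun_add
      (hp.const_mul (Real.exp (2 * b * y)))).const_mul b⁻¹ using 1
    rw [← mul_assoc, ← mul_assoc, em, ep]
    field_simp
    ring
  · intro t _
    positivity
  · refine Tendsto.const_mul _ (Tendsto.add (Tendsto.const_mul _ ?_) (Tendsto.const_mul _ ?_))
    · refine tendsto_integral_exp_neg_sq_atBot.comp ?_
      simpa [sub_eq_add_neg] using hb0.add_atBot (tendsto_neg_atTop_atBot.comp hy0)
    · exact tendsto_integral_exp_neg_sq_atTop.comp (hb0.add_atTop hy0)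
  · refine Tendsto.const_mul _ (Tendsto.add (Tendsto.const_mul _ ?_) (Tendsto.const_mul _ ?_))
    · refine tendsto_integral_exp_neg_sq_atTop.comp ?_
      simpa [sub_eq_add_neg] using hbt.atTop_add hyt.neg
    · exact tendsto_integral_exp_neg_sq_atTop.comp (hbt.atTop_add hyt)

/-- The kernel `g` as a Laplace transform of the heat kernel in the space variable. -/
theorem g_eq_integral (r θ z : ℝ) {t : ℝ} (ht : 0 < t) :
    g r θ t z = ∫ v in Ioi (0 : ℝ), 2 * θ / √(2 * Real.pi) *
      (Real.exp (-(z + v) ^ 2 / (2 * t)) / √t * Real.exp (-(2 * r * θ) * v)) := by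
  set s := √(2 * t) with hs
  have hs0 : 0 < s := Real.sqrt_pos.2 (by positivity)
  have hsq : s ^ 2 = 2 * t := Real.sq_sqrt (by positivity)
  set c := z / s + r * θ * s with hc
  have h1 : ∫ u in Ioi c, Real.exp (-u ^ 2) =
      ∫ w in Ioi (0 : ℝ), Real.exp (-(w + c) ^ 2) := by
    have := (measurePreserving_add_right volume c).setIntegral_preimage_emb
      (measurableEmbedding_addRight c) (fun u : ℝ => Real.exp (-u ^ 2)) (Ioi c)
    simpa using this.symm
  have h2 := integral_comp_mul_left_Ioi (fun w : ℝ => Real.exp (-(w + c) ^ 2)) 0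
    (inv_pos.2 hs0)
  simp only [mul_zero, inv_inv, smul_eq_mul] at h2
  have h3 : ∫ w in Ioi (0 : ℝ), Real.exp (-(w + c) ^ 2) =
      s⁻¹ * ∫ v in Ioi (0 : ℝ), Real.exp (-(s⁻¹ * v + c) ^ 2) := by
    rw [h2, inv_mul_cancel_left₀ hs0.ne']
  rw [g, erfc, ← hs, ← hc, h1, h3, ← mul_assoc, ← mul_assoc, ← integral_const_mul]
  refine integral_congr_ae (Eventually.of_forall fun v => ?_)
  have he : Real.exp (2 * r * θ * z + 2 * r ^ 2 * θ ^ 2 * t) * Real.exp (-(s⁻¹ * v + c) ^ 2) =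
      Real.exp (-(z + v) ^ 2 / (2 * t)) * Real.exp (-(2 * r * θ) * v) := by
    rw [← Real.exp_add, ← Real.exp_add]
    congr 1
    rw [← hsq, show 2 * r ^ 2 * θ ^ 2 * t = r ^ 2 * θ ^ 2 * s ^ 2 by rw [hsq]; ring, hc]
    field_simp
    ring
  have hk : 2 / √Real.pi * s⁻¹ = 2 / √(2 * Real.pi) / √t := by
    rw [hs, Real.sqrt_mul zero_le_two, Real.sqrt_mul zero_le_two]
    field_simp
  calc _ = θ * (2 / √Real.pi * s⁻¹) * (Real.exp (2 * r * θ * z + 2 * r ^ 2 * θ ^ 2 * t) *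
        Real.exp (-(s⁻¹ * v + c) ^ 2)) := by ring
    _ = _ := by rw [he, hk]; ring

/-- Laplace transform of the kernel `g`. -/
theorem g_laplace (r θ : ℝ) (hr : 0 < r) (hθ : 0 < θ) (z lam : ℝ)
    (hz : 0 ≤ z) (hlam : 0 < lam) :
    ∫ t in Set.Ioi (0 : ℝ), Real.exp (-lam * t) * g r θ t z =
      θ * Real.exp (-z * Real.sqrt (2 * lam)) /
        (lam + Real.sqrt (2 * lam) * r * θ) := by
  set γ := √(2 * lam) with hγ
  have hγ0 : 0 < γ := Real.sqrt_pos.2 (by positivity)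
  have hγsq : γ ^ 2 = 2 * lam := Real.sq_sqrt (by positivity)
  set C := 2 * θ / √(2 * Real.pi) with hC
  set K : ℝ → ℝ → ℝ := fun t v =>
    C * (Real.exp (-lam * t - (z + v) ^ 2 / (2 * t)) / √t * Real.exp (-(2 * r * θ) * v)) with hK
  have hC0 : 0 < C := by positivity
  have hrep : ∀ t ∈ Ioi (0 : ℝ), Real.exp (-lam * t) * g r θ t z = ∫ v in Ioi (0 : ℝ), K t v := by
    intro t ht
    rw [g_eq_integral r θ z ht, ← integral_const_mul]
    refine integral_congr_ae (Eventually.of_forall fun v => ?_)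
    simp only [hK]
    rw [sub_eq_add_neg, Real.exp_add, neg_div]
    ring
  have hexp : ∀ t v : ℝ, Real.exp (-lam * t - (z + v) ^ 2 / (2 * t)) =
      Real.exp (-√lam ^ 2 * t - ((z + v) / √2) ^ 2 / t) := by
    intro t v
    rw [Real.sq_sqrt hlam.le, div_pow, Real.sq_sqrt zero_le_two, div_div]
  have hinner : ∀ v ∈ Ioi (0 : ℝ), IntegrableOn (fun t => K t v) (Ioi 0) ∧
      ∫ t in Ioi (0 : ℝ), K t v =
        2 * θ / γ * Real.exp (-γ * z) * Real.exp (-(γ + 2 * r * θ) * v) := by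
    intro v hv
    have hzv : 0 < z + v := add_pos_of_nonneg_of_pos hz hv
    obtain ⟨hi, hI⟩ := integrableOn_and_integral_exp_neg_mul_sub_div_div_sqrt
      (Real.sqrt_pos.2 hlam) (y := (z + v) / √2) (by positivity)
    simp only [hK, hexp]
    refine ⟨(hi.mul_const _).const_mul _, ?_⟩
    rw [integral_const_mul, integral_mul_const, hI]
    have hg : γ = √2 * √lam := Real.sqrt_mul zero_le_two lam
    have he : -2 * √lam * ((z + v) / √2) = -γ * z + -γ * v := by
      rw [hg]
      field_simp
      rw [Real.sq_sqrt zero_le_two]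
      ring
    have hk : C * (√Real.pi / √lam) = 2 * θ / γ := by
      rw [hC, hg, Real.sqrt_mul zero_le_two]
      field_simp
    rw [he, Real.exp_add, ← hk, show -(γ + 2 * r * θ) * v = -γ * v + -(2 * r * θ) * v by ring,
      Real.exp_add]
    ring
  have hdecay : 0 < γ + 2 * r * θ := by positivity
  have hint : Integrable (Function.uncurry K)
      ((volume.restrict (Ioi (0 : ℝ))).prod (volume.restrict (Ioi (0 : ℝ)))) := by
    have hmeas : Measurable (Function.uncurry K) := by
      simp only [hK, Function.uncurry_def]
      fun_prop
    refine (integrable_prod_iff' hmeas.aestronglyMeasurable).2 ⟨?_, ?_⟩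
    · filter_upwards [ae_restrict_mem measurableSet_Ioi] with v hv
      exact (hinner v hv).1
    · refine IntegrableOn.congr_fun ((exp_neg_integrableOn_Ioi 0 hdecay).const_mul
        (2 * θ / γ * Real.exp (-γ * z))) (fun v hv => ?_) measurableSet_Ioi
      rw [← (hinner v hv).2]
      refine integral_congr_ae (Eventually.of_forall fun t => ?_)
      have : 0 ≤ K t v := by positivity
      exact (Real.norm_of_nonneg this).symm
  rw [setIntegral_congr_fun measurableSet_Ioi hrep, integral_integral_swap hint,
    setIntegral_congr_fun measurableSet_Ioi fun v hv => (hinner v hv).2, integral_const_mul,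
    integral_exp_mul_Ioi (neg_lt_zero.2 hdecay), mul_zero, Real.exp_zero, neg_div_neg_eq,
    show lam + γ * r * θ = γ * (γ + 2 * r * θ) / 2 by linear_combination (-1 / 2) * hγsq,
    show -z * γ = -γ * z by ring]
  field_simp
end

section
/- Let σ₊, σ₋, θ > 0. For every y ≥ 0 and all a, b, c > 0, the triple integral over the region {(t, τ, l) : 0 < l/θ < τ < t} of exp(−a·t − b·τ − c·l) · [l / (4π·σ₊·σ₋·(τ − l/θ)^{1/2}·(t − τ)^{3/2})] · exp(−l²/(8σ₋²(t − τ)) − (y + l/2)²/(2σ₊²(τ − l/θ))) with respect to dl dτ dt equals exp(−(y/σ₊)·√(2(a+b))) / (σ₊·√(2(a+b)) · (c + (a+b)/θ + √(2a)/(2σ₋) + √(2(a+b))/(2σ₊))). -/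
open MeasureTheory Set

/-- A nonnegative measurable function of three real variables may be integrated iteratively in
either order: a value of the iterated Lebesgue integral in reverse order is also the value of the
iterated Bochner integral. -/
theorem integral_integral_integral_eq_of_lintegral {f : ℝ → ℝ → ℝ → ℝ}
    (hf : Measurable fun p : ℝ × ℝ × ℝ => f p.1 p.2.1 p.2.2) (h0 : ∀ x y z, 0 ≤ f x y z)
    {R : ℝ} (hR : 0 ≤ R)
    (h : ∫⁻ z, ∫⁻ y, ∫⁻ x, ENNReal.ofReal (f x y z) = ENNReal.ofReal R) :
    ∫ x, ∫ y, ∫ z, f x y z = R := by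
  have hfm := hf.ennreal_ofReal
  have key : ∫⁻ p : ℝ × ℝ × ℝ, ENNReal.ofReal (f p.1 p.2.1 p.2.2) = ENNReal.ofReal R := by
    rw [← h, Measure.volume_eq_prod, lintegral_prod_symm _ hfm.aemeasurable,
      Measure.volume_eq_prod, lintegral_prod_symm]
    exact (Measurable.lintegral_prod_left' hfm).aemeasurable
  have hfi : Integrable (fun p : ℝ × ℝ × ℝ => f p.1 p.2.1 p.2.2) (volume.prod volume) := by
    refine ⟨hf.aestronglyMeasurable, ?_⟩
    rw [hasFiniteIntegral_iff_ofReal (ae_of_all _ fun p => h0 _ _ _)]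
    rw [Measure.volume_eq_prod] at key
    rw [key]
    exact ENNReal.ofReal_lt_top
  have h1 : ∫ p : ℝ × ℝ × ℝ, f p.1 p.2.1 p.2.2 = R := by
    rw [integral_eq_lintegral_of_nonneg_ae (ae_of_all _ fun p => h0 _ _ _)
      hf.aestronglyMeasurable, key, ENNReal.toReal_ofReal hR]
  rw [← h1, Measure.volume_eq_prod, integral_prod _ hfi]
  refine integral_congr_ae ?_
  filter_upwards [hfi.prod_right_ae] with x hx
  exact (integral_prod _ hx).symm

theorem hasDerivAt_mul_sqrt_sub_div_sqrt (q m : ℝ) {u : ℝ} (hu : 0 < u) :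
    HasDerivAt (fun u => q * √u - m / √u) (q / (2 * √u) + m / (2 * (u * √u))) u := by
  have hs : 0 < √u := Real.sqrt_pos.2 hu
  have h := Real.hasDerivAt_sqrt hu.ne'
  refine ((h.const_mul q).sub ((hasDerivAt_const u m).div h hs.ne')).congr_deriv ?_
  have h2 : √u ^ 2 = u := Real.sq_sqrt hu.le
  rw [h2]
  field_simp
  ring

theorem strictMonoOn_mul_sqrt_sub_div_sqrt {q m : ℝ} (hq : 0 < q) (hm : 0 < m) :
    StrictMonoOn (fun u => q * √u - m / √u) (Ioi 0) := by
  intro u hu v hv huv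
  have hs : 0 < √u := Real.sqrt_pos.2 hu
  have hlt : √u < √v := Real.sqrt_lt_sqrt (le_of_lt hu) huv
  have h1 : q * √u < q * √v := by gcongr
  have h2 : m / √v < m / √u := by gcongr
  simp only
  linarith

theorem image_mul_sqrt_sub_div_sqrt {q m : ℝ} (hq : 0 < q) (hm : 0 < m) :
    (fun u => q * √u - m / √u) '' Ioi 0 = univ := by
  refine eq_univ_of_forall fun z => ?_
  have hd : 0 < z ^ 2 + 4 * q * m := by positivity
  have hsq := Real.sq_sqrt hd.le
  have hlt : |z| < √(z ^ 2 + 4 * q * m) := by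
    rw [← Real.sqrt_sq_eq_abs]
    exact Real.sqrt_lt_sqrt (sq_nonneg z) (by nlinarith [mul_pos hq hm])
  have hx : 0 < (z + √(z ^ 2 + 4 * q * m)) / (2 * q) := by
    have := neg_abs_le z
    exact div_pos (by linarith) (by positivity)
  have hne : z + √(z ^ 2 + 4 * q * m) ≠ 0 := by
    have := neg_abs_le z
    exact (by linarith : 0 < z + √(z ^ 2 + 4 * q * m)).ne'
  refine ⟨((z + √(z ^ 2 + 4 * q * m)) / (2 * q)) ^ 2, by simp only [mem_Ioi]; positivity, ?_⟩
  simp only [Real.sqrt_sq hx.le]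
  generalize √(z ^ 2 + 4 * q * m) = S at hsq hne
  field_simp
  linear_combination hsq

theorem neg_half_sq_mul_sqrt_sub_div_sqrt (q m : ℝ) {u : ℝ} (hu : 0 < u) :
    -(q * √u - m / √u) ^ 2 / 2 = q * m + (-(q ^ 2 * u / 2) - m ^ 2 / (2 * u)) := by
  have hs : 0 < √u := Real.sqrt_pos.2 hu
  have h2 : √u ^ 2 = u := Real.sq_sqrt hu.le
  have : -(q * √u - m / √u) ^ 2 / 2
      = q * m + (-(q ^ 2 * √u ^ 2 / 2) - m ^ 2 / (2 * √u ^ 2)) := by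
    field_simp
    ring
  rw [this, h2]

theorem lintegral_exp_neg_half_sq :
    ∫⁻ x : ℝ, ENNReal.ofReal (Real.exp (-x ^ 2 / 2)) = ENNReal.ofReal √(2 * Real.pi) := by
  have e : (fun x : ℝ => Real.exp (-x ^ 2 / 2)) = fun x => Real.exp (-(1 / 2) * x ^ 2) := by
    ext x; ring_nf
  rw [← ofReal_integral_eq_lintegral_ofReal, e, integral_gaussian]
  · congr 2; ring
  · rw [e]; exact integrable_exp_neg_mul_sq (by norm_num)
  · exact ae_of_all _ fun x => (Real.exp_pos _).le

theorem lintegral_gaussian_sum {q m : ℝ} (hq : 0 < q) (hm : 0 < m) :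
    ∫⁻ u in Ioi (0 : ℝ), ENNReal.ofReal ((q / (2 * √u) + m / (2 * (u * √u))) *
      Real.exp (-(q ^ 2 * u / 2) - m ^ 2 / (2 * u))) =
    ENNReal.ofReal (√(2 * Real.pi) * Real.exp (-(q * m))) := by
  have h := lintegral_image_eq_lintegral_abs_deriv_mul measurableSet_Ioi
    (fun u (hu : u ∈ Ioi (0 : ℝ)) => (hasDerivAt_mul_sqrt_sub_div_sqrt q m hu).hasDerivWithinAt)
    (strictMonoOn_mul_sqrt_sub_div_sqrt hq hm).injOn
    (fun x => ENNReal.ofReal (Real.exp (-x ^ 2 / 2)))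
  rw [image_mul_sqrt_sub_div_sqrt hq hm, setLIntegral_univ, lintegral_exp_neg_half_sq] at h
  rw [mul_comm, ENNReal.ofReal_mul (Real.exp_pos _).le, h,
    ← lintegral_const_mul' _ _ ENNReal.ofReal_ne_top]
  refine setLIntegral_congr_fun measurableSet_Ioi fun u hu => ?_
  have hu' : 0 < u := hu
  have hw : 0 ≤ q / (2 * √u) + m / (2 * (u * √u)) := by positivity
  rw [neg_half_sq_mul_sqrt_sub_div_sqrt q m hu', abs_of_nonneg hw, ← ENNReal.ofReal_mul hw,
    ← ENNReal.ofReal_mul (Real.exp_pos _).le, Real.exp_add, Real.exp_neg (q * m)]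
  congr 1
  field_simp

theorem lintegral_gaussian_swap {q m : ℝ} (hq : 0 < q) (hm : 0 < m) :
    ∫⁻ u in Ioi (0 : ℝ), ENNReal.ofReal (q / (2 * √u) *
      Real.exp (-(q ^ 2 * u / 2) - m ^ 2 / (2 * u))) =
    ∫⁻ u in Ioi (0 : ℝ), ENNReal.ofReal (m / (2 * (u * √u)) *
      Real.exp (-(q ^ 2 * u / 2) - m ^ 2 / (2 * u))) := by
  have hk : 0 < (m / q) ^ 2 := by positivity
  have him : (fun u : ℝ => (m / q) ^ 2 / u) '' Ioi 0 = Ioi 0 := by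
    ext v
    constructor
    · rintro ⟨u, hu, rfl⟩
      exact div_pos hk hu
    · intro hv
      exact ⟨(m / q) ^ 2 / v, div_pos hk hv, div_div_cancel₀ hk.ne'⟩
  have hinj : InjOn (fun u : ℝ => (m / q) ^ 2 / u) (Ioi 0) := by
    intro u _ v _ huv
    have := congrArg (fun x => (m / q) ^ 2 / x) huv
    simpa only [div_div_cancel₀ hk.ne'] using this
  have h := lintegral_image_eq_lintegral_abs_deriv_mul measurableSet_Ioi
    (fun u (hu : u ∈ Ioi (0 : ℝ)) =>
      ((hasDerivAt_const u ((m / q) ^ 2)).div (hasDerivAt_id u)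
        (ne_of_gt hu)).hasDerivWithinAt) hinj
    (fun u => ENNReal.ofReal (q / (2 * √u) *
      Real.exp (-(q ^ 2 * u / 2) - m ^ 2 / (2 * u))))
  have him' : ((fun _ : ℝ => (m / q) ^ 2) / id) '' Ioi 0 = Ioi (0 : ℝ) := him
  rw [him'] at h
  rw [h]
  refine setLIntegral_congr_fun measurableSet_Ioi fun u hu => ?_
  have hu' : 0 < u := hu
  have hs : 0 < √u := Real.sqrt_pos.2 hu'
  simp only [Pi.div_apply, id, zero_mul, mul_one, zero_sub]
  rw [abs_div, abs_neg, abs_of_pos hk, abs_of_pos (by positivity : 0 < u ^ 2),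
    ← ENNReal.ofReal_mul (by positivity), Real.sqrt_div hk.le, Real.sqrt_sq (by positivity)]
  have e1 : -(q ^ 2 * ((m / q) ^ 2 / u) / 2) - m ^ 2 / (2 * ((m / q) ^ 2 / u))
      = -(q ^ 2 * u / 2) - m ^ 2 / (2 * u) := by
    field_simp
    ring
  rw [e1, ← mul_assoc]
  congr 2
  have h2 : u = √u ^ 2 := (Real.sq_sqrt hu'.le).symm
  field_simp
  rw [← h2]

theorem lintegral_gaussian_div_mul_sqrt {q m : ℝ} (hq : 0 < q) (hm : 0 < m) :
    ∫⁻ u in Ioi (0 : ℝ), ENNReal.ofReal (m / (2 * (u * √u)) *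
      Real.exp (-(q ^ 2 * u / 2) - m ^ 2 / (2 * u))) =
    ENNReal.ofReal (√(2 * Real.pi) * Real.exp (-(q * m)) / 2) := by
  have hsum := lintegral_gaussian_sum hq hm
  have : ∫⁻ u in Ioi (0 : ℝ), ENNReal.ofReal ((q / (2 * √u) + m / (2 * (u * √u))) *
      Real.exp (-(q ^ 2 * u / 2) - m ^ 2 / (2 * u))) =
      ∫⁻ u in Ioi (0 : ℝ), (ENNReal.ofReal (q / (2 * √u) *
        Real.exp (-(q ^ 2 * u / 2) - m ^ 2 / (2 * u))) + ENNReal.ofReal (m / (2 * (u * √u)) *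
        Real.exp (-(q ^ 2 * u / 2) - m ^ 2 / (2 * u)))) := by
    refine setLIntegral_congr_fun measurableSet_Ioi fun u hu => ?_
    have hu' : 0 < u := hu
    rw [← ENNReal.ofReal_add (by positivity) (by positivity), add_mul]
  rw [this, lintegral_add_left (by fun_prop), lintegral_gaussian_swap hq hm, ← two_mul] at hsum
  rw [ENNReal.ofReal_div_of_pos two_pos, ← hsum, ENNReal.ofReal_ofNat, mul_comm,
    ENNReal.mul_div_cancel_right two_ne_zero ENNReal.ofNat_ne_top]

/-- Laplace transform of the one-dimensional heat kernel. -/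
theorem lintegral_rpow_neg_half_mul_exp {q m : ℝ} (hq : 0 < q) (hm : 0 < m) :
    ∫⁻ u in Ioi (0 : ℝ), ENNReal.ofReal ((u ^ ((1 : ℝ) / 2))⁻¹ *
      Real.exp (-(q ^ 2 * u / 2) - m ^ 2 / (2 * u))) =
    ENNReal.ofReal (√(2 * Real.pi) * Real.exp (-(q * m)) / q) := by
  have h := (lintegral_gaussian_swap hq hm).trans (lintegral_gaussian_div_mul_sqrt hq hm)
  have e : √(2 * Real.pi) * Real.exp (-(q * m)) / q
      = 2 / q * (√(2 * Real.pi) * Real.exp (-(q * m)) / 2) := by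
    field_simp
  rw [e, ENNReal.ofReal_mul (by positivity), ← h, ← lintegral_const_mul' _ _ ENNReal.ofReal_ne_top]
  refine setLIntegral_congr_fun measurableSet_Ioi fun u hu => ?_
  have hu' : 0 < u := hu
  rw [← ENNReal.ofReal_mul (by positivity), ← Real.sqrt_eq_rpow]
  congr 1
  field_simp

/-- Laplace transform of the first passage density of Brownian motion. -/
theorem lintegral_rpow_neg_three_half_mul_exp {q m : ℝ} (hq : 0 < q) (hm : 0 < m) :
    ∫⁻ u in Ioi (0 : ℝ), ENNReal.ofReal ((u ^ ((3 : ℝ) / 2))⁻¹ *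
      Real.exp (-(q ^ 2 * u / 2) - m ^ 2 / (2 * u))) =
    ENNReal.ofReal (√(2 * Real.pi) * Real.exp (-(q * m)) / m) := by
  have h := lintegral_gaussian_div_mul_sqrt hq hm
  have e : √(2 * Real.pi) * Real.exp (-(q * m)) / m
      = 2 / m * (√(2 * Real.pi) * Real.exp (-(q * m)) / 2) := by
    field_simp
  rw [e, ENNReal.ofReal_mul (by positivity), ← h, ← lintegral_const_mul' _ _ ENNReal.ofReal_ne_top]
  refine setLIntegral_congr_fun measurableSet_Ioi fun u hu => ?_
  have hu' : 0 < u := hu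
  have e2 : u ^ ((3 : ℝ) / 2) = u * √u := by
    rw [Real.sqrt_eq_rpow, ← Real.rpow_one_add' hu'.le (by norm_num)]
    norm_num
  rw [← ENNReal.ofReal_mul (by positivity), e2]
  congr 1
  field_simp

theorem lintegral_exp_neg_mul {r : ℝ} (hr : 0 < r) :
    ∫⁻ l in Ioi (0 : ℝ), ENNReal.ofReal (Real.exp (-r * l)) = ENNReal.ofReal (1 / r) := by
  rw [← ofReal_integral_eq_lintegral_ofReal (integrableOn_exp_mul_Ioi (neg_lt_zero.2 hr) 0)
    (ae_of_all _ fun x => (Real.exp_pos _).le), integral_exp_mul_Ioi (neg_lt_zero.2 hr)]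
  congr 1
  simp

/-- The joint density of time, occupation time and local time, weighted by the Laplace kernel. -/
noncomputable def laplaceIntegrand (σp σm θ y a b c t τ l : ℝ) : ℝ :=
  Real.exp (-a * t - b * τ - c * l) *
    (l / (4 * Real.pi * σp * σm * (τ - l / θ) ^ ((1 : ℝ) / 2) *
      (t - τ) ^ ((3 : ℝ) / 2))) *
    Real.exp (-l ^ 2 / (8 * σm ^ 2 * (t - τ)) -
      (y + l / 2) ^ 2 / (2 * σp ^ 2 * (τ - l / θ)))

/-- The region `0 < l / θ < τ < t` of triples `(t, τ, l)`. -/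
def laplaceRegion (θ : ℝ) : Set (ℝ × ℝ × ℝ) :=
  {p | 0 < p.2.2 ∧ p.2.2 < θ * p.2.1 ∧ p.2.1 < p.1}

theorem measurableSet_laplaceRegion (θ : ℝ) : MeasurableSet (laplaceRegion θ) :=
  (measurableSet_lt measurable_const measurable_snd.snd).inter
    ((measurableSet_lt measurable_snd.snd (measurable_snd.fst.const_mul θ)).inter
      (measurableSet_lt measurable_snd.fst measurable_fst))

theorem laplaceIntegrand_nonneg {σp σm θ : ℝ} (hσp : 0 < σp) (hσm : 0 < σm) (hθ : 0 < θ)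
    (y a b c : ℝ) {t τ l : ℝ} (h : (t, τ, l) ∈ laplaceRegion θ) :
    0 ≤ laplaceIntegrand σp σm θ y a b c t τ l := by
  obtain ⟨h1, h2, h3⟩ := h
  simp only at h1 h2 h3
  have hu : 0 ≤ τ - l / θ := by
    rw [sub_nonneg, div_le_iff₀ hθ]
    linarith
  have hs : 0 ≤ t - τ := by linarith
  unfold laplaceIntegrand
  positivity

/-- In the coordinates `s = t - τ`, `u = τ - l / θ` the integrand is a product. -/
theorem laplaceIntegrand_shift {σp σm θ : ℝ} (hσp : 0 < σp) (hσm : 0 < σm) (hθ : 0 < θ)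
    (y a b c : ℝ) (ha : 0 < a) (hb : 0 < b) {s u : ℝ} (hs : 0 < s) (hu : 0 < u) (l : ℝ) :
    laplaceIntegrand σp σm θ y a b c (s + (u + l / θ)) (u + l / θ) l =
      l / (4 * Real.pi * σp * σm) * Real.exp (-(c + (a + b) / θ) * l) *
        ((u ^ ((1 : ℝ) / 2))⁻¹ *
          Real.exp (-(√(2 * (a + b)) ^ 2 * u / 2) - ((y + l / 2) / σp) ^ 2 / (2 * u))) *
        ((s ^ ((3 : ℝ) / 2))⁻¹ *
          Real.exp (-(√(2 * a) ^ 2 * s / 2) - (l / (2 * σm)) ^ 2 / (2 * s))) := by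
  have hu2 : 0 < u ^ ((1 : ℝ) / 2) := by positivity
  have hs2 : 0 < s ^ ((3 : ℝ) / 2) := by positivity
  rw [laplaceIntegrand, add_sub_cancel_right, add_sub_cancel_right,
    Real.sq_sqrt (by positivity), Real.sq_sqrt (by positivity)]
  generalize u ^ ((1 : ℝ) / 2) = U at hu2
  generalize s ^ ((3 : ℝ) / 2) = S at hs2
  have e : Real.exp (-a * (s + (u + l / θ)) - b * (u + l / θ) - c * l) *
      Real.exp (-l ^ 2 / (8 * σm ^ 2 * s) - (y + l / 2) ^ 2 / (2 * σp ^ 2 * u)) =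
      Real.exp (-(c + (a + b) / θ) * l) *
        Real.exp (-(2 * (a + b) * u / 2) - ((y + l / 2) / σp) ^ 2 / (2 * u)) *
        Real.exp (-(2 * a * s / 2) - (l / (2 * σm)) ^ 2 / (2 * s)) := by
    rw [← Real.exp_add, ← Real.exp_add, ← Real.exp_add]
    congr 1
    field_simp
    ring
  calc _ = l / (4 * Real.pi * σp * σm * U * S) *
        (Real.exp (-a * (s + (u + l / θ)) - b * (u + l / θ) - c * l) *
          Real.exp (-l ^ 2 / (8 * σm ^ 2 * s) - (y + l / 2) ^ 2 / (2 * σp ^ 2 * u))) := by ring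
    _ = _ := by
      rw [e]
      field_simp

theorem lintegral_laplaceIntegrand_slice {σp σm θ : ℝ} (hσp : 0 < σp) (hσm : 0 < σm)
    (hθ : 0 < θ) {y a b c : ℝ} (hy : 0 ≤ y) (ha : 0 < a) (hb : 0 < b) {l : ℝ} (hl : 0 < l) :
    ∫⁻ τ, ∫⁻ t, ENNReal.ofReal ((laplaceRegion θ).indicator
      (fun p => laplaceIntegrand σp σm θ y a b c p.1 p.2.1 p.2.2) (t, τ, l)) =
    ENNReal.ofReal (Real.exp (-(y / σp) * √(2 * (a + b))) / (σp * √(2 * (a + b)))) *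
      ENNReal.ofReal (Real.exp
        (-(c + (a + b) / θ + √(2 * a) / (2 * σm) + √(2 * (a + b)) / (2 * σp)) * l)) := by
  have hr : 0 < √(2 * a) := by positivity
  have hp : 0 < √(2 * (a + b)) := by positivity
  set C := l / (4 * Real.pi * σp * σm) * Real.exp (-(c + (a + b) / θ) * l) with hC
  have hC0 : 0 ≤ C := by positivity
  set φ : ℝ → ℝ := fun u => (u ^ ((1 : ℝ) / 2))⁻¹ *
    Real.exp (-(√(2 * (a + b)) ^ 2 * u / 2) - ((y + l / 2) / σp) ^ 2 / (2 * u))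
  set ψ : ℝ → ℝ := fun s => (s ^ ((3 : ℝ) / 2))⁻¹ *
    Real.exp (-(√(2 * a) ^ 2 * s / 2) - (l / (2 * σm)) ^ 2 / (2 * s))
  have hprod : ∀ u s : ℝ, ENNReal.ofReal ((laplaceRegion θ).indicator
      (fun p => laplaceIntegrand σp σm θ y a b c p.1 p.2.1 p.2.2)
        (s + (u + l / θ), u + l / θ, l)) =
      ENNReal.ofReal C * (Ioi 0).indicator (fun u => ENNReal.ofReal (φ u)) u *
        (Ioi 0).indicator (fun s => ENNReal.ofReal (ψ s)) s := by
    intro u s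
    have hmem : (s + (u + l / θ), u + l / θ, l) ∈ laplaceRegion θ ↔ 0 < u ∧ 0 < s := by
      have e : θ * (u + l / θ) = θ * u + l := by field_simp
      simp only [laplaceRegion, mem_ofPred_eq, hl, true_and, e, lt_add_iff_pos_left,
        mul_pos_iff_of_pos_left hθ]
    by_cases hu : 0 < u
    · by_cases hs : 0 < s
      · have hφ0 : 0 ≤ φ u := by positivity
        rw [indicator_of_mem (hmem.2 ⟨hu, hs⟩), indicator_of_mem (mem_Ioi.2 hu),
          indicator_of_mem (mem_Ioi.2 hs), ← ENNReal.ofReal_mul hC0,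
          ← ENNReal.ofReal_mul (mul_nonneg hC0 hφ0)]
        exact congrArg _ (laplaceIntegrand_shift hσp hσm hθ y a b c ha hb hs hu l)
      · rw [indicator_of_notMem fun h => hs (hmem.1 h).2,
          indicator_of_notMem (s := Ioi (0 : ℝ)) (a := s) hs]
        simp
    · rw [indicator_of_notMem fun h => hu (hmem.1 h).1,
        indicator_of_notMem (s := Ioi (0 : ℝ)) (a := u) hu]
      simp
  rw [← lintegral_add_right_eq_self _ (l / θ)]
  have hinner : ∀ u : ℝ, ∫⁻ t, ENNReal.ofReal ((laplaceRegion θ).indicator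
      (fun p => laplaceIntegrand σp σm θ y a b c p.1 p.2.1 p.2.2) (t, u + l / θ, l)) =
      ENNReal.ofReal C * (∫⁻ s in Ioi (0 : ℝ), ENNReal.ofReal (ψ s)) *
        (Ioi 0).indicator (fun u => ENNReal.ofReal (φ u)) u := by
    intro u
    rw [← lintegral_add_right_eq_self _ (u + l / θ)]
    simp_rw [hprod]
    rw [lintegral_const_mul _ (Measurable.indicator (by fun_prop) measurableSet_Ioi),
      lintegral_indicator measurableSet_Ioi]
    ring
  simp_rw [hinner]
  rw [lintegral_const_mul _ (Measurable.indicator (by fun_prop) measurableSet_Ioi),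
    lintegral_indicator measurableSet_Ioi,
    lintegral_rpow_neg_half_mul_exp hp (by positivity),
    lintegral_rpow_neg_three_half_mul_exp hr (by positivity),
    ← ENNReal.ofReal_mul hC0, ← ENNReal.ofReal_mul (by positivity),
    ← ENNReal.ofReal_mul (by positivity)]
  congr 1
  have hpi : √(2 * Real.pi) * √(2 * Real.pi) = 2 * Real.pi :=
    Real.mul_self_sqrt (by positivity)
  generalize √(2 * a) = r at *
  generalize √(2 * (a + b)) = p at *
  have e : Real.exp (-(c + (a + b) / θ) * l) * Real.exp (-(r * (l / (2 * σm)))) *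
      Real.exp (-(p * ((y + l / 2) / σp))) = Real.exp (-(y / σp) * p) *
      Real.exp (-(c + (a + b) / θ + r / (2 * σm) + p / (2 * σp)) * l) := by
    simp only [← Real.exp_add]
    congr 1
    field_simp
    ring
  calc _ = (√(2 * Real.pi) * √(2 * Real.pi)) * (l / (4 * Real.pi * σp * σm)) /
        (p * (l / (2 * σm))) * (Real.exp (-(c + (a + b) / θ) * l) *
          Real.exp (-(r * (l / (2 * σm)))) * Real.exp (-(p * ((y + l / 2) / σp)))) := by
        rw [hC]
        field_simp
    _ = _ := by
        rw [e, hpi]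
        field_simp
        ring

theorem setIntegral_laplaceIntegrand_eq {θ : ℝ} (hθ : 0 < θ) (g : ℝ → ℝ → ℝ → ℝ) :
    ∫ t in Ioi (0 : ℝ), ∫ τ in Ioo (0 : ℝ) t, ∫ l in Ioo (0 : ℝ) (θ * τ), g t τ l =
      ∫ t, ∫ τ, ∫ l,
        (laplaceRegion θ).indicator (fun p => g p.1 p.2.1 p.2.2) (t, τ, l) := by
  have h1 : ∀ t τ : ℝ, ∫ l, (laplaceRegion θ).indicator
      (fun p => g p.1 p.2.1 p.2.2) (t, τ, l) =
      (Ioo 0 t).indicator (fun τ => ∫ l in Ioo (0 : ℝ) (θ * τ), g t τ l) τ := by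
    intro t τ
    by_cases hτ : τ ∈ Ioo 0 t
    · rw [indicator_of_mem hτ, ← integral_indicator measurableSet_Ioo]
      congr 1 with l
      simp only [indicator, laplaceRegion, mem_ofPred_eq, hτ.2, and_true, mem_Ioo]
    · rw [indicator_of_notMem hτ]
      refine integral_eq_zero_of_ae (ae_of_all _ fun l => indicator_of_notMem ?_ _)
      rintro ⟨hl, hlt, htt⟩
      exact hτ ⟨pos_of_mul_pos_right (hl.trans hlt) hθ.le, htt⟩
  simp_rw [h1, integral_indicator measurableSet_Ioo]
  rw [← integral_indicator measurableSet_Ioi]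
  congr 1 with t
  by_cases ht : t ∈ Ioi (0 : ℝ)
  · rw [indicator_of_mem ht]
  · rw [indicator_of_notMem ht, Ioo_eq_empty ht, setIntegral_empty]

/-- Trivariate Laplace transform identity at the core of Theorem 3.2. -/
theorem trivariate_laplace (σp σm θ : ℝ) (hσp : 0 < σp) (hσm : 0 < σm)
    (hθ : 0 < θ) (y : ℝ) (hy : 0 ≤ y) (a b c : ℝ)
    (ha : 0 < a) (hb : 0 < b) (hc : 0 < c) :
    (∫ t in Set.Ioi (0 : ℝ), ∫ τ in Set.Ioo (0 : ℝ) t,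
        ∫ l in Set.Ioo (0 : ℝ) (θ * τ),
          Real.exp (-a * t - b * τ - c * l) *
            (l / (4 * Real.pi * σp * σm * (τ - l / θ) ^ ((1 : ℝ) / 2) *
              (t - τ) ^ ((3 : ℝ) / 2))) *
            Real.exp (-l ^ 2 / (8 * σm ^ 2 * (t - τ)) -
              (y + l / 2) ^ 2 / (2 * σp ^ 2 * (τ - l / θ)))) =
      Real.exp (-(y / σp) * Real.sqrt (2 * (a + b))) /
        (σp * Real.sqrt (2 * (a + b)) *
          (c + (a + b) / θ + Real.sqrt (2 * a) / (2 * σm) +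
            Real.sqrt (2 * (a + b)) / (2 * σp))) := by
  have hK : 0 < c + (a + b) / θ + √(2 * a) / (2 * σm) + √(2 * (a + b)) / (2 * σp) := by
    positivity
  refine (setIntegral_laplaceIntegrand_eq hθ (laplaceIntegrand σp σm θ y a b c)).trans ?_
  refine integral_integral_integral_eq_of_lintegral (f := fun t τ l =>
    (laplaceRegion θ).indicator (fun p => laplaceIntegrand σp σm θ y a b c p.1 p.2.1 p.2.2)
      (t, τ, l)) ?_ (fun t τ l => indicator_apply_nonneg fun h =>
        laplaceIntegrand_nonneg hσp hσm hθ y a b c h) (by positivity) ?_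
  · refine Measurable.indicator ?_ (measurableSet_laplaceRegion θ)
    unfold laplaceIntegrand
    fun_prop
  have hslice : ∀ l : ℝ, ∫⁻ τ, ∫⁻ t, ENNReal.ofReal ((laplaceRegion θ).indicator
      (fun p => laplaceIntegrand σp σm θ y a b c p.1 p.2.1 p.2.2) (t, τ, l)) =
      (Ioi 0).indicator (fun l => ENNReal.ofReal
        (Real.exp (-(y / σp) * √(2 * (a + b))) / (σp * √(2 * (a + b)))) *
        ENNReal.ofReal (Real.exp
          (-(c + (a + b) / θ + √(2 * a) / (2 * σm) + √(2 * (a + b)) / (2 * σp)) * l))) l := by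
    intro l
    by_cases hl : 0 < l
    · rw [indicator_of_mem (mem_Ioi.2 hl)]
      exact lintegral_laplaceIntegrand_slice hσp hσm hθ hy ha hb hl
    · rw [indicator_of_notMem (s := Ioi (0 : ℝ)) (a := l) hl]
      have h0 : ∀ t τ : ℝ, (t, τ, l) ∉ laplaceRegion θ := fun t τ h => hl h.1
      simp [indicator_of_notMem (h0 _ _)]
  simp_rw [hslice]
  rw [lintegral_indicator measurableSet_Ioi, lintegral_const_mul' _ _ ENNReal.ofReal_ne_top,
    lintegral_exp_neg_mul hK, ← ENNReal.ofReal_mul (by positivity), div_mul_div_comm, mul_one]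
end

section
/- Let σ₊, σ₋, θ > 0 and let 0 < τ < t. Then ∫_0^{θτ} ∫_0^∞ [ σ₊^{−2}·h(t − τ, l/(2σ₋))·h(τ − l/θ, (y + l/2)/σ₊) + σ₋^{−2}·h(τ − l/θ, l/(2σ₊))·h(t − τ, (y + l/2)/σ₋) ] dy dl = (θ² / (4π·σ₊·σ₋·(t − τ)^{3/2})) · ∫_0^τ ( 1/√(τ − l) + (t − τ)/(τ − l)^{3/2} ) · l · exp(−(θl)²/(8σ₊²(τ − l)) − (θl)²/(8σ₋²(t − τ))) dl. -/
open MeasureTheory Filter Topology Real in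
/-- The first passage density, with its space variable rescaled by `σ` and shifted by `c`, is
integrable over the half-line, with Gaussian total mass. -/
theorem integrableOn_and_integral_h {s σ c : ℝ} (hs : 0 < s) (hσ : 0 < σ) (hc : 0 ≤ c) :
    IntegrableOn (fun y => h s ((y + c) / σ)) (Set.Ioi 0) ∧
      ∫ y in Set.Ioi (0 : ℝ), h s ((y + c) / σ) =
        σ * s / (√(2 * π) * s ^ ((3 : ℝ) / 2)) * exp (-(c / σ) ^ 2 / (2 * s)) := by
  have hs' : 0 < s ^ ((3 : ℝ) / 2) := rpow_pos_of_pos hs _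
  have hπ : 0 < √(2 * π) := by positivity
  set F : ℝ → ℝ := fun y =>
    -(σ * s / (√(2 * π) * s ^ ((3 : ℝ) / 2))) * exp (-((y + c) / σ) ^ 2 / (2 * s)) with hF
  have hderiv : ∀ y ∈ Set.Ici (0 : ℝ), HasDerivAt F (h s ((y + c) / σ)) y := by
    intro y _
    have := ((((((hasDerivAt_id y).add_const c).div_const σ).pow 2).neg.div_const
      (2 * s)).exp).const_mul (-(σ * s / (√(2 * π) * s ^ ((3 : ℝ) / 2))))
    refine this.congr_deriv ?_
    simp only [h, id, Pi.pow_apply, Pi.neg_apply]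
    field_simp
    norm_num
    field_simp
  have hnonneg : ∀ y ∈ Set.Ioi (0 : ℝ), 0 ≤ h s ((y + c) / σ) := by
    intro y hy
    have : 0 < y := hy
    unfold h
    positivity
  have hlim : Tendsto F atTop (𝓝 0) := by
    rw [← mul_zero (-(σ * s / (√(2 * π) * s ^ ((3 : ℝ) / 2))))]
    refine (tendsto_exp_atBot.comp ?_).const_mul _
    refine Tendsto.atBot_div_const (by positivity) (tendsto_neg_atTop_atBot.comp ?_)
    exact (tendsto_pow_atTop two_ne_zero).comp
      ((tendsto_atTop_add_const_right _ c tendsto_id).atTop_div_const hσ)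
  refine ⟨integrableOn_Ioi_deriv_of_nonneg' hderiv hnonneg hlim, ?_⟩
  rw [integral_Ioi_of_hasDerivAt_of_nonneg' hderiv hnonneg hlim]
  simp [hF]

open MeasureTheory Real in
/-- The trivariate density integrated over the position variable. -/
theorem integral_position_density {σp σm s r l : ℝ} (hσp : 0 < σp) (hσm : 0 < σm)
    (hs : 0 < s) (hr : 0 < r) (hl : 0 ≤ l) :
    ∫ y in Set.Ioi (0 : ℝ), (σp⁻¹ ^ 2 * h r (l / (2 * σm)) * h s ((y + l / 2) / σp) +
        σm⁻¹ ^ 2 * h s (l / (2 * σp)) * h r ((y + l / 2) / σm)) =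
      1 / (4 * π * σp * σm * r ^ ((3 : ℝ) / 2)) *
        ((1 / √s + r / s ^ ((3 : ℝ) / 2)) * l *
          exp (-l ^ 2 / (8 * σp ^ 2 * s) - l ^ 2 / (8 * σm ^ 2 * r))) := by
  obtain ⟨hpi, hp⟩ := integrableOn_and_integral_h hs hσp (div_nonneg hl two_pos.le)
  obtain ⟨hmi, hm⟩ := integrableOn_and_integral_h hr hσm (div_nonneg hl two_pos.le)
  rw [integral_add (hpi.const_mul _) (hmi.const_mul _), integral_const_mul, integral_const_mul,
    hp, hm]
  have hpow : s ^ ((3 : ℝ) / 2) = s * √s := by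
    rw [show (3 : ℝ) / 2 = 1 + 1 / 2 by norm_num, rpow_add hs, rpow_one, sqrt_eq_rpow]
  have hexp : exp (-l ^ 2 / (8 * σp ^ 2 * s) - l ^ 2 / (8 * σm ^ 2 * r)) =
      exp (-(l / 2 / σp) ^ 2 / (2 * s)) * exp (-(l / 2 / σm) ^ 2 / (2 * r)) := by
    rw [← exp_add]
    congr 1
    field_simp
    ring
  have hq : √(2 * π) ^ 2 = 2 * π := sq_sqrt (by positivity)
  have hr' : 0 < r ^ ((3 : ℝ) / 2) := rpow_pos_of_pos hr _
  have hs' : 0 < √s := sqrt_pos.2 hs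
  simp only [h, hexp, hpow, ← div_div l 2]
  generalize exp (-(l / 2 / σp) ^ 2 / (2 * s)) = A
  generalize exp (-(l / 2 / σm) ^ 2 / (2 * r)) = B
  generalize r ^ ((3 : ℝ) / 2) = R at *
  generalize √s = S at *
  have hQ : 0 < √(2 * π) := by positivity
  field_simp
  rw [hq]
  ring


/-- Occupation time density of the oscillating sticky Brownian motion
(Corollary 3.4, with corrected constants). -/
theorem occupation_time_density (σp σm θ τ t : ℝ) (hσp : 0 < σp) (hσm : 0 < σm)
    (hθ : 0 < θ) (hτ : 0 < τ) (hτt : τ < t) :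
    (∫ l in (0 : ℝ)..(θ * τ), ∫ y in Set.Ioi (0 : ℝ),
        (σp⁻¹ ^ 2 * h (t - τ) (l / (2 * σm)) * h (τ - l / θ) ((y + l / 2) / σp) +
          σm⁻¹ ^ 2 * h (τ - l / θ) (l / (2 * σp)) * h (t - τ) ((y + l / 2) / σm))) =
      (θ ^ 2 / (4 * Real.pi * σp * σm * (t - τ) ^ ((3 : ℝ) / 2))) *
        ∫ l in (0 : ℝ)..τ,
          (1 / Real.sqrt (τ - l) + (t - τ) / (τ - l) ^ ((3 : ℝ) / 2)) * l *
            Real.exp (-(θ * l) ^ 2 / (8 * σp ^ 2 * (τ - l)) -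
              (θ * l) ^ 2 / (8 * σm ^ 2 * (t - τ))) := by
  have hr : 0 < t - τ := sub_pos.2 hτt
  have hsub := intervalIntegral.mul_integral_comp_mul_left (a := 0) (b := τ)
    (f := fun l => ∫ y in Set.Ioi (0 : ℝ),
        (σp⁻¹ ^ 2 * h (t - τ) (l / (2 * σm)) * h (τ - l / θ) ((y + l / 2) / σp) +
          σm⁻¹ ^ 2 * h (τ - l / θ) (l / (2 * σp)) * h (t - τ) ((y + l / 2) / σm))) θ
  rw [mul_zero] at hsub
  rw [← hsub, ← intervalIntegral.integral_const_mul, ← intervalIntegral.integral_const_mul]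
  refine intervalIntegral.integral_congr_Ioo_of_le hτ.le fun l hl => ?_
  have hl' : θ * l / θ = l := by field_simp
  simp only [hl']
  rw [integral_position_density hσp hσm (sub_pos.2 hl.2) hr (mul_pos hθ hl.1).le]
  ring
end
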